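/- For every γ > 0 and t > 0, ∫_ℝ e^{γ|y|} p(t; 0, y) · 2 e^{-2γ|y|} dy = 2 Φ(γ√t), where p(t; x, y) = (1/(2√(2πt))) exp( γ(|x| + |y|) − (γ²/2) t − (x − y)²/(2t) ) + (γ/4) Erfc( (|x| + |y| − γt)/√(2t) ). In particular this quantity converges to 2 as t → ∞. -/

import Mathlib

open MeasureTheory Real Set Filter

/-- The standard normal distribution function `Φ`. -/
noncomputable def stdNormalCDF (x : ℝ) : ℝ :=
  ∫ u in Set.Iic x, (Real.sqrt (2 * Real.pi))⁻¹ * Real.exp (-u ^ 2 / 2)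

/-- The complementary error function `Erfc`. -/
noncomputable def erfc (x : ℝ) : ℝ :=
  (2 / Real.sqrt Real.pi) * ∫ u in Set.Ioi x, Real.exp (-u ^ 2)

/-- The transition density `p(t; x, y)`, with respect to the speed measure
`m(dy) = 2 e^{-2γ|y|} dy`, of a Brownian motion with constant drift `γ` towards the origin. -/
noncomputable def transDensity (γ t x y : ℝ) : ℝ :=
  (1 / (2 * Real.sqrt (2 * Real.pi * t))) *
      Real.exp (γ * (|x| + |y|) - γ ^ 2 / 2 * t - (x - y) ^ 2 / (2 * t)) +
    (γ / 4) * erfc ((|x| + |y| - γ * t) / Real.sqrt (2 * t))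

lemma erfc_aux_int : Integrable (fun u : ℝ => Real.exp (-u ^ 2)) := by
  simpa using integrable_exp_neg_mul_sq (b := 1) one_pos

lemma erfc_aux_hasDerivAt (x : ℝ) :
    HasDerivAt erfc (-((2 / Real.sqrt Real.pi) * Real.exp (-x ^ 2))) x := by
  have h1 : erfc = fun x => (2 / Real.sqrt Real.pi) *
      ((∫ u in Set.Ioi (0 : ℝ), Real.exp (-u ^ 2)) - ∫ u in (0 : ℝ)..x, Real.exp (-u ^ 2)) := by
    funext z
    unfold erfc
    rw [← intervalIntegral.integral_interval_add_Ioi (a := 0) (b := z)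
      erfc_aux_int.integrableOn erfc_aux_int.integrableOn]
    ring
  rw [h1]
  have hc : Continuous (fun u : ℝ => Real.exp (-u ^ 2)) := by fun_prop
  have h2 := intervalIntegral.integral_hasDerivAt_right (hc.intervalIntegrable 0 x)
    (hc.stronglyMeasurableAtFilter _ _) hc.continuousAt
  exact ((h2.const_sub _).const_mul (2 / Real.sqrt Real.pi)).congr_deriv (by ring)

lemma erfc_aux_nonneg (x : ℝ) : 0 ≤ erfc x := by
  unfold erfc
  have : 0 ≤ ∫ u in Set.Ioi x, Real.exp (-u ^ 2) :=
    integral_nonneg fun u => (Real.exp_pos _).le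
  positivity

lemma erfc_aux_le (x : ℝ) : erfc x ≤ (2 / Real.sqrt Real.pi) * ∫ u : ℝ, Real.exp (-u ^ 2) := by
  unfold erfc
  gcongr
  · exact ae_of_all _ fun u => (Real.exp_pos _).le
  · exact erfc_aux_int
  · exact Measure.restrict_le_self

lemma cdf_aux (x : ℝ) : stdNormalCDF x = erfc (-x / Real.sqrt 2) / 2 := by
  unfold stdNormalCDF erfc
  have h1 := integral_comp_neg_Iic x (fun u : ℝ => (Real.sqrt (2 * Real.pi))⁻¹ * Real.exp (-u ^ 2 / 2))
  simp only [neg_sq] at h1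
  have h2 := integral_comp_mul_left_Ioi (fun u : ℝ => Real.exp (-u ^ 2)) (-x)
    (b := (Real.sqrt 2)⁻¹) (by positivity)
  have hs : Real.sqrt 2 ^ 2 = 2 := Real.sq_sqrt (by norm_num)
  have h3 : ∀ u : ℝ, -((Real.sqrt 2)⁻¹ * u) ^ 2 = -u ^ 2 / 2 := by
    intro u
    rw [mul_pow, inv_pow, hs]; ring
  simp only [h3] at h2
  rw [h1, integral_const_mul, h2, Real.sqrt_mul (by norm_num), smul_eq_mul,
    show (Real.sqrt 2)⁻¹ * -x = -x / Real.sqrt 2 by ring]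
  have : Real.sqrt 2 ≠ 0 := by positivity
  have : Real.sqrt Real.pi ≠ 0 := by positivity
  field_simp

lemma cdf_aux_tendsto : Tendsto stdNormalCDF atTop (nhds 1) := by
  have hi : Integrable (fun u : ℝ => (Real.sqrt (2 * Real.pi))⁻¹ * Real.exp (-u ^ 2 / 2)) := by
    have := (integrable_exp_neg_mul_sq (b := 1 / 2) (by norm_num)).const_mul
      (Real.sqrt (2 * Real.pi))⁻¹
    convert this using 4
    ring
  have h := (aecover_Iic (μ := volume) (tendsto_id (α := ℝ))).integral_tendsto_of_countably_generated hi
  have hv : ∫ u : ℝ, (Real.sqrt (2 * Real.pi))⁻¹ * Real.exp (-u ^ 2 / 2) = 1 := by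
    have := integral_gaussian (1 / 2)
    rw [integral_const_mul, show (fun u : ℝ => Real.exp (-u ^ 2 / 2)) =
      fun u : ℝ => Real.exp (-(1 / 2) * u ^ 2) from funext fun u => by ring_nf, this,
      show Real.pi / (1 / 2) = 2 * Real.pi by ring]
    exact inv_mul_cancel₀ (by positivity)
  rw [hv] at h
  exact h

lemma main_aux (γ : ℝ) (hγ : 0 < γ) (t : ℝ) (ht : 0 < t) :
    (∫ y : ℝ, Real.exp (γ * |y|) * transDensity γ t 0 y * (2 * Real.exp (-2 * γ * |y|))) =
          2 * stdNormalCDF (γ * Real.sqrt t) := by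
  set g : ℝ → ℝ := fun y => (Real.sqrt (2 * Real.pi * t))⁻¹ *
      Real.exp (-(γ ^ 2 / 2 * t) - y ^ 2 / (2 * t)) +
      γ / 2 * Real.exp (-(γ * y)) * erfc ((y - γ * t) / Real.sqrt (2 * t)) with hg
  have e1 : ∀ y : ℝ, Real.exp (γ * |y|) * transDensity γ t 0 y * (2 * Real.exp (-2 * γ * |y|))
      = g |y| := by
    intro y
    simp only [hg, transDensity, abs_zero, zero_add, zero_sub, neg_sq, sq_abs]
    have a1 : Real.exp (γ * |y| - γ ^ 2 / 2 * t - y ^ 2 / (2 * t)) =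
        Real.exp (γ * |y|) * Real.exp (-(γ ^ 2 / 2 * t) - y ^ 2 / (2 * t)) := by
      rw [← Real.exp_add]; ring_nf
    have a2 : Real.exp (-2 * γ * |y|) = Real.exp (-(γ * |y|)) * Real.exp (-(γ * |y|)) := by
      rw [← Real.exp_add]; ring_nf
    have a3 : Real.exp (γ * |y|) * Real.exp (-(γ * |y|)) = 1 := by
      rw [← Real.exp_add]; simp
    rw [a1, a2]
    have a4 : Real.exp (-(γ * |y|)) = (Real.exp (γ * |y|))⁻¹ := Real.exp_neg _
    rw [a4]
    have := Real.exp_ne_zero (γ * |y|)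
    have : Real.sqrt (2 * Real.pi * t) ≠ 0 := by positivity
    field_simp
    ring
  simp_rw [e1]
  rw [integral_comp_abs (f := g)]
  congr 1
  set F : ℝ → ℝ := fun y => -(1 / 2) * (Real.exp (-(γ * y)) * erfc ((y - γ * t) / Real.sqrt (2 * t))) with hF
  have hd : ∀ y, HasDerivAt F (g y) y := by
    intro y
    have d1 : HasDerivAt (fun y : ℝ => Real.exp (-(γ * y))) (Real.exp (-(γ * y)) * (-(γ * 1))) y :=
      (((hasDerivAt_id y).const_mul γ).neg).exp
    have d2 : HasDerivAt (fun y : ℝ => (y - γ * t) / Real.sqrt (2 * t)) (1 / Real.sqrt (2 * t)) y :=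
      ((hasDerivAt_id y).sub_const _).div_const _
    have d3 := (erfc_aux_hasDerivAt ((y - γ * t) / Real.sqrt (2 * t))).comp y d2
    have d4 := (d1.mul d3).const_mul (-(1 / 2))
    refine d4.congr_deriv ?_
    have hs : Real.sqrt (2 * t) ^ 2 = 2 * t := Real.sq_sqrt (by positivity)
    have b1 : Real.exp (-(γ ^ 2 / 2 * t) - y ^ 2 / (2 * t)) =
        Real.exp (-(γ * y)) * Real.exp (-((y - γ * t) / Real.sqrt (2 * t)) ^ 2) := by
      rw [← Real.exp_add, div_pow, hs]
      congr 1
      field_simp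
      ring
    have b2 : Real.sqrt (2 * Real.pi * t) = Real.sqrt Real.pi * Real.sqrt (2 * t) := by
      rw [← Real.sqrt_mul Real.pi_pos.le]; ring_nf
    simp only [hg, Function.comp]
    rw [b1, b2]
    have : Real.sqrt (2 * t) ≠ 0 := by positivity
    have : Real.sqrt Real.pi ≠ 0 := by positivity
    field_simp
    ring
  have hg0 : ∀ y, 0 ≤ g y := by
    intro y
    have := erfc_aux_nonneg ((y - γ * t) / Real.sqrt (2 * t))
    simp only [hg]
    positivity
  have hl : Tendsto F atTop (nhds 0) := by
    have k1 : Tendsto (fun y : ℝ => Real.exp (-(γ * y))) atTop (nhds 0) :=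
      Real.tendsto_exp_neg_atTop_nhds_zero.comp (tendsto_id.const_mul_atTop hγ)
    have k2 := k1.mul_const ((2 / Real.sqrt Real.pi) * ∫ u : ℝ, Real.exp (-u ^ 2))
    rw [zero_mul] at k2
    have k3 : Tendsto (fun y : ℝ => Real.exp (-(γ * y)) * erfc ((y - γ * t) / Real.sqrt (2 * t)))
        atTop (nhds 0) :=
      squeeze_zero (fun y => mul_nonneg (Real.exp_pos _).le (erfc_aux_nonneg _))
        (fun y => mul_le_mul_of_nonneg_left (erfc_aux_le _) (Real.exp_pos _).le) k2
    have k4 := k3.const_mul (-(1 / 2))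
    rw [mul_zero] at k4
    exact k4
  rw [integral_Ioi_of_hasDerivAt_of_nonneg (hd 0).continuousAt.continuousWithinAt
    (fun y _ => hd y) (fun y _ => hg0 y) hl, cdf_aux]
  have c1 : (0 - γ * t) / Real.sqrt (2 * t) = -(γ * Real.sqrt t) / Real.sqrt 2 := by
    rw [Real.sqrt_mul (by norm_num)]
    have : Real.sqrt t ≠ 0 := by positivity
    have : Real.sqrt t ^ 2 = t := Real.sq_sqrt ht.le
    field_simp
    rw [this]; ring
  simp only [hF]
  rw [c1, mul_zero, neg_zero, Real.exp_zero]
  ring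

/-- `E^{Q̃_γ}(e^{γ |ξ_t|}) = 2 Φ(γ √t)`, and in particular this converges to `2` as `t → ∞`. -/
theorem integral_exp_abs_transDensity (γ : ℝ) (hγ : 0 < γ) :
    (∀ t : ℝ, 0 < t →
        (∫ y : ℝ, Real.exp (γ * |y|) * transDensity γ t 0 y * (2 * Real.exp (-2 * γ * |y|))) =
          2 * stdNormalCDF (γ * Real.sqrt t)) ∧
      Tendsto (fun t : ℝ =>
          ∫ y : ℝ, Real.exp (γ * |y|) * transDensity γ t 0 y * (2 * Real.exp (-2 * γ * |y|)))
        atTop (nhds 2) := by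
  refine ⟨fun t ht => main_aux γ hγ t ht, ?_⟩
  have h := (cdf_aux_tendsto.comp (Real.tendsto_sqrt_atTop.const_mul_atTop hγ)).const_mul 2
  rw [mul_one] at h
  refine h.congr' ?_
  filter_upwards [eventually_gt_atTop 0] with t ht
  exact (main_aux γ hγ t ht).symm
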